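/- Let a < b be real numbers and let ℓ ≥ 1 be a natural number. For every v_a, v_b ∈ ℝ and every function g : ℕ → ℝ, there exists a unique real polynomial p of degree at most ℓ such that p(a) = v_a, p(b) = v_b, and ∫_a^b p(x) x^j dx = g(j) for every natural number j with j < ℓ − 1 (no integral conditions when ℓ = 1). -/

import Mathlib

open Polynomial intervalIntegral

/-- The bubble `(x - a) (b - x)` weights squares of nonzero polynomials positively. -/
theorem integral_bubble_mul_sq_pos {a b : ℝ} (hab : a < b) {q : ℝ[X]} (hq : q ≠ 0) :
    0 < ∫ x in a..b, (x - a) * (b - x) * q.eval x ^ 2 := by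
  obtain ⟨c, hc, hqc⟩ : ∃ c ∈ Set.Ioo a b, q.eval c ≠ 0 := by
    by_contra! h
    exact hq (q.eq_zero_of_infinite_isRoot ((Set.Ioo_infinite hab).mono h))
  refine intervalIntegral.integral_pos hab (by fun_prop) (fun x hx => ?_)
    ⟨c, Set.Ioo_subset_Icc_self hc, ?_⟩
  · have h₁ : 0 ≤ x - a := sub_nonneg.2 hx.1.le
    have h₂ : 0 ≤ b - x := sub_nonneg.2 hx.2
    positivity
  · have h₁ : 0 < c - a := sub_pos.2 hc.1
    have h₂ : 0 < b - c := sub_pos.2 hc.2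
    positivity

/-- If the moments of `p` of order less than `n` vanish, then `p` is `L²`-orthogonal to all
polynomials of degree less than `n`. -/
theorem integral_eval_mul_eval_eq_zero {a b : ℝ} {p q : ℝ[X]} {n : ℕ} (hq : q.natDegree < n)
    (h : ∀ j < n, (∫ x in a..b, p.eval x * x ^ j) = 0) :
    (∫ x in a..b, p.eval x * q.eval x) = 0 := by
  simp_rw [eval_eq_sum_range' hq, Finset.mul_sum, mul_left_comm]
  rw [intervalIntegral.integral_finsetSum
    fun i _ => Continuous.intervalIntegrable (by fun_prop) a b]
  refine Finset.sum_eq_zero fun i hi => ?_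
  rw [intervalIntegral.integral_const_mul, h i (Finset.mem_range.1 hi), mul_zero]

theorem eq_zero_of_endpoints_of_moments {a b : ℝ} (hab : a < b) {ℓ : ℕ} {p : ℝ[X]}
    (hp : p.natDegree ≤ ℓ) (ha : p.eval a = 0) (hb : p.eval b = 0)
    (h : ∀ j < ℓ - 1, (∫ x in a..b, p.eval x * x ^ j) = 0) : p = 0 := by
  obtain ⟨r, rfl⟩ := dvd_iff_isRoot.2 ha
  have hr : r.eval b = 0 := by simpa [sub_ne_zero.2 hab.ne'] using hb
  obtain ⟨q, rfl⟩ := dvd_iff_isRoot.2 hr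
  by_contra hne
  have hq : q ≠ 0 := by
    rintro rfl
    simp at hne
  rw [natDegree_mul (X_sub_C_ne_zero a) (mul_ne_zero (X_sub_C_ne_zero b) hq),
    natDegree_mul (X_sub_C_ne_zero b) hq, natDegree_X_sub_C, natDegree_X_sub_C] at hp
  have h₀ := integral_eval_mul_eval_eq_zero (q := q) (by omega) h
  have h₁ := integral_bubble_mul_sq_pos hab hq
  rw [← neg_eq_zero, ← intervalIntegral.integral_neg] at h₀
  refine h₁.ne' (h₀ ▸ intervalIntegral.integral_congr fun x _ => ?_)
  simp only [eval_mul, eval_sub, eval_X, eval_C]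
  ring

/-- The endpoint values and the first `n` monomial moments on `[a, b]`. -/
noncomputable def endpointsMoments (a b : ℝ) (n : ℕ) : ℝ[X] →ₗ[ℝ] ℝ × ℝ × (Fin n → ℝ) where
  toFun p := (p.eval a, p.eval b, fun j => ∫ x in a..b, p.eval x * x ^ (j : ℕ))
  map_add' p q := by
    ext j
    · simp
    · simp
    · simp only [eval_add, add_mul, Prod.snd_add, Pi.add_apply]
      exact intervalIntegral.integral_add (Continuous.intervalIntegrable (by fun_prop) a b)
        (Continuous.intervalIntegrable (by fun_prop) a b)
  map_smul' c p := by
    ext j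
    · simp
    · simp
    · simp [mul_assoc]

theorem mem_degreeLT_succ_iff {p : ℝ[X]} {n : ℕ} :
    p ∈ degreeLT ℝ (n + 1) ↔ p.natDegree ≤ n := by
  simp only [mem_degreeLT, degree_lt_iff_coeff_zero, natDegree_le_iff_coeff_eq_zero,
    Nat.succ_le_iff]

theorem endpointsMoments_bijective {a b : ℝ} (hab : a < b) {ℓ : ℕ} (hℓ : 1 ≤ ℓ) :
    Function.Bijective ((endpointsMoments a b (ℓ - 1)).domRestrict (degreeLT ℝ (ℓ + 1))) := by
  have hdim : Module.finrank ℝ (degreeLT ℝ (ℓ + 1)) =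
      Module.finrank ℝ (ℝ × ℝ × (Fin (ℓ - 1) → ℝ)) := by
    rw [(degreeLTEquiv ℝ (ℓ + 1)).finrank_eq]
    simp only [Module.finrank_prod, Module.finrank_fin_fun, Module.finrank_self]
    omega
  have : FiniteDimensional ℝ (degreeLT ℝ (ℓ + 1)) :=
    Module.Finite.equiv (degreeLTEquiv ℝ (ℓ + 1)).symm
  have hinj : Function.Injective
      ((endpointsMoments a b (ℓ - 1)).domRestrict (degreeLT ℝ (ℓ + 1))) := by
    refine (injective_iff_map_eq_zero _).2 fun ⟨p, hp⟩ h => Subtype.ext ?_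
    simp only [LinearMap.domRestrict_apply, endpointsMoments, LinearMap.coe_mk, AddHom.coe_mk,
      Prod.mk_eq_zero] at h
    exact eq_zero_of_endpoints_of_moments hab (mem_degreeLT_succ_iff.1 hp) h.1 h.2.1
      fun j hj => congrFun h.2.2 ⟨j, hj⟩
  exact ⟨hinj, (LinearMap.injective_iff_surjective_of_finrank_eq_finrank hdim).1 hinj⟩

theorem h1_conforming_edge_projection_wellposed
    (a b : ℝ) (hab : a < b) (ℓ : ℕ) (hℓ : 1 ≤ ℓ)
    (va vb : ℝ) (g : ℕ → ℝ) :
    ∃! p : Polynomial ℝ, p.natDegree ≤ ℓ ∧ p.eval a = va ∧ p.eval b = vb ∧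
      ∀ j : ℕ, j < ℓ - 1 → (∫ x in a..b, p.eval x * x ^ j) = g j := by
  have hiff (p : ℝ[X]) : endpointsMoments a b (ℓ - 1) p = (va, vb, fun j : Fin (ℓ - 1) => g j) ↔
      p.eval a = va ∧ p.eval b = vb ∧
        ∀ j : ℕ, j < ℓ - 1 → (∫ x in a..b, p.eval x * x ^ j) = g j := by
    simp [endpointsMoments, funext_iff, Fin.forall_iff]
  obtain ⟨⟨p, hp⟩, hval, huniq⟩ :=
    (endpointsMoments_bijective hab hℓ).existsUnique (va, vb, fun j : Fin (ℓ - 1) => g j)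
  refine ⟨p, ⟨mem_degreeLT_succ_iff.1 hp, (hiff p).1 hval⟩, fun r hr => ?_⟩
  exact congrArg Subtype.val (huniq ⟨r, mem_degreeLT_succ_iff.2 hr.1⟩ ((hiff r).2 hr.2))
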